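/- (Vanishing successive differences and subsequential convergence to stationarity.) Under the stated assumptions and for β > max{β′, β″}: (a) the successive differences Δxᵢ^k → 0 for i = 1,…,4 and Δλ^k → 0 as k → ∞; and (b) every limit point (x̂, λ̂) of the sequence {(x^k, λ^k)} is a stationary point of L_β, i.e., x̂₁ ∈ M, x̂₁ = x̂₂, x̂₃ = x̂₄, Proj_{T_{x̂₁}M}(∇₁f(x̂) + ∇₁g(x̂₁,x̂₂) − λ̂₁) = 0, ∇₂f(x̂) + ∇₂g(x̂₁,x̂₂) + λ̂₁ = 0, ∇₃f(x̂) = λ̂₂, and ∇₄f(x̂) = −λ̂₂, where Proj_{T_pM} acts blockwise on each 4-coordinate block by v ↦ v − ⟨pᵢ, vᵢ⟩ pᵢ. -/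

import Mathlib

open scoped RealInnerProductSpace
open Matrix

noncomputable section

/-- `ℝ^{4n}`, regarded as `n` blocks of `ℝ⁴`. -/
abbrev E4 (n : ℕ) := EuclideanSpace ℝ (Fin n × Fin 4)

/-- `ℝ^{3n}`, regarded as `n` blocks of `ℝ³`. -/
abbrev E3 (n : ℕ) := EuclideanSpace ℝ (Fin n × Fin 3)

/-- The product of `n` unit spheres in `ℝ⁴`: each 4-coordinate block has norm 1. -/
def Msph (n : ℕ) : Set (E4 n) := {x | ∀ i : Fin n, ∑ j : Fin 4, x (i, j) ^ 2 = 1}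

/-- Partial gradient of `f` w.r.t. its first block. -/
def grad1f {n : ℕ} (f : E4 n → E4 n → E3 n → E3 n → ℝ) (a b : E4 n) (c d : E3 n) : E4 n :=
  gradient (fun y => f y b c d) a

/-- Partial gradient of `f` w.r.t. its second block. -/
def grad2f {n : ℕ} (f : E4 n → E4 n → E3 n → E3 n → ℝ) (a b : E4 n) (c d : E3 n) : E4 n :=
  gradient (fun y => f a y c d) b

/-- Partial gradient of `f` w.r.t. its third block. -/
def grad3f {n : ℕ} (f : E4 n → E4 n → E3 n → E3 n → ℝ) (a b : E4 n) (c d : E3 n) : E3 n :=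
  gradient (fun y => f a b y d) c

/-- Partial gradient of `f` w.r.t. its fourth block. -/
def grad4f {n : ℕ} (f : E4 n → E4 n → E3 n → E3 n → ℝ) (a b : E4 n) (c d : E3 n) : E3 n :=
  gradient (fun y => f a b c y) d

/-- Partial gradient of `g` w.r.t. its first block. -/
def grad1g {n : ℕ} (g : E4 n → E4 n → ℝ) (a b : E4 n) : E4 n :=
  gradient (fun y => g y b) a

/-- Partial gradient of `g` w.r.t. its second block. -/
def grad2g {n : ℕ} (g : E4 n → E4 n → ℝ) (a b : E4 n) : E4 n :=
  gradient (fun y => g a y) b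

/-- The quadratic form `‖v‖²_H = ⟨v, Hv⟩` of a matrix `H`. -/
def qf {ι : Type*} [Fintype ι] [DecidableEq ι] (H : Matrix ι ι ℝ)
    (v : EuclideanSpace ℝ ι) : ℝ :=
  ⟪v, Matrix.toEuclideanLin H v⟫

/-- The augmented Lagrangian
`L_β(x,λ) = f + g − ⟨λ₁, x₁−x₂⟩ − ⟨λ₂, x₃−x₄⟩ + (β/2)(‖x₁−x₂‖² + ‖x₃−x₄‖²)`. -/
def augL {n : ℕ} (f : E4 n → E4 n → E3 n → E3 n → ℝ) (g : E4 n → E4 n → ℝ) (β : ℝ)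
    (x1 x2 : E4 n) (x3 x4 : E3 n) (l1 : E4 n) (l2 : E3 n) : ℝ :=
  f x1 x2 x3 x4 + g x1 x2 - ⟪l1, x1 - x2⟫ - ⟪l2, x3 - x4⟫ +
    β / 2 * (‖x1 - x2‖ ^ 2 + ‖x3 - x4‖ ^ 2)


/-- Blockwise projection onto the tangent space of the product of spheres at `p`:
on each 4-block, `v ↦ v − ⟨pᵢ, vᵢ⟩ pᵢ`. -/
def projM {n : ℕ} (p v : E4 n) : E4 n :=
  (WithLp.equiv 2 ((Fin n × Fin 4) → ℝ)).symm fun ij =>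
    v ij - (∑ j' : Fin 4, p (ij.1, j') * v (ij.1, j')) * p ij

theorem sum_inner_eigenvectorBasis_sq {ι : Type*} [Fintype ι] [DecidableEq ι]
    {H : Matrix ι ι ℝ} (hH : H.IsHermitian) (v : EuclideanSpace ℝ ι) :
    ∑ i, ⟪hH.eigenvectorBasis i, v⟫ ^ 2 = ‖v‖ ^ 2 := by
  simpa using hH.eigenvectorBasis.sum_sq_norm_inner_right v

theorem inner_eigenvectorBasis_toEuclideanLin {ι : Type*} [Fintype ι] [DecidableEq ι]
    {H : Matrix ι ι ℝ} (hH : H.IsHermitian) (v : EuclideanSpace ℝ ι) (i : ι) :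
    ⟪hH.eigenvectorBasis i, Matrix.toEuclideanLin H v⟫ =
      hH.eigenvalues i * ⟪hH.eigenvectorBasis i, v⟫ := by
  have hs := Matrix.isSymmetric_toEuclideanLin_iff.mpr hH
  have he : Matrix.toEuclideanLin H (hH.eigenvectorBasis i) =
      hH.eigenvalues i • hH.eigenvectorBasis i := by
    rw [Matrix.toLpLin_apply, hH.mulVec_eigenvectorBasis i]
    rfl
  rw [← hs, he, real_inner_smul_left]

theorem eigenvalues_mem_eigenvalueSet {ι : Type*} [Fintype ι] [DecidableEq ι]
    {H : Matrix ι ι ℝ} (hH : H.IsHermitian) (i : ι) :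
    hH.eigenvalues i ∈ {μ : ℝ | ∃ v : ι → ℝ, v ≠ 0 ∧ H *ᵥ v = μ • v} :=
  ⟨_, (WithLp.ofLp_eq_zero 2).ne.2 <| hH.eigenvectorBasis.orthonormal.ne_zero i,
    hH.mulVec_eigenvectorBasis i⟩

theorem mul_norm_sq_le_qf {ι : Type*} [Fintype ι] [DecidableEq ι] {H : Matrix ι ι ℝ}
    (hH : H.IsHermitian) {κ : ℝ}
    (hκ : IsLeast {μ : ℝ | ∃ v : ι → ℝ, v ≠ 0 ∧ H *ᵥ v = μ • v} κ)
    (v : EuclideanSpace ℝ ι) : κ * ‖v‖ ^ 2 ≤ qf H v := by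
  rw [qf, ← hH.eigenvectorBasis.sum_inner_mul_inner, ← sum_inner_eigenvectorBasis_sq hH v,
    Finset.mul_sum]
  refine Finset.sum_le_sum fun i _ => ?_
  rw [inner_eigenvectorBasis_toEuclideanLin, real_inner_comm (hH.eigenvectorBasis i) v]
  have := mul_le_mul_of_nonneg_right (hκ.2 (eigenvalues_mem_eigenvalueSet hH i))
    (sq_nonneg ⟪hH.eigenvectorBasis i, v⟫)
  linarith

theorem norm_toEuclideanLin_sq_le {ι : Type*} [Fintype ι] [DecidableEq ι] {H : Matrix ι ι ℝ}
    (hH : H.PosDef) {κ : ℝ}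
    (hκ : IsGreatest {μ : ℝ | ∃ v : ι → ℝ, v ≠ 0 ∧ H *ᵥ v = μ • v} κ)
    (v : EuclideanSpace ℝ ι) : ‖Matrix.toEuclideanLin H v‖ ^ 2 ≤ κ ^ 2 * ‖v‖ ^ 2 := by
  rw [← sum_inner_eigenvectorBasis_sq hH.1, ← sum_inner_eigenvectorBasis_sq hH.1 v,
    Finset.mul_sum]
  refine Finset.sum_le_sum fun i _ => ?_
  rw [inner_eigenvectorBasis_toEuclideanLin, mul_pow]
  exact mul_le_mul_of_nonneg_right
    (pow_le_pow_left₀ (hH.eigenvalues_pos i).le (hκ.2 (eigenvalues_mem_eigenvalueSet hH.1 i)) 2)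
    (sq_nonneg _)

theorem eigenvalue_pos_of_posDef {ι : Type*} [Fintype ι] [DecidableEq ι] {H : Matrix ι ι ℝ}
    (hH : H.PosDef) {κ : ℝ} (hκ : ∃ v : ι → ℝ, v ≠ 0 ∧ H *ᵥ v = κ • v) : 0 < κ := by
  obtain ⟨v, hv, he⟩ := hκ
  have h := hH.dotProduct_mulVec_pos hv
  rw [he, dotProduct_smul, smul_eq_mul] at h
  exact pos_of_mul_pos_left h (dotProduct_star_self_nonneg v)

theorem qf_smul {ι : Type*} [Fintype ι] [DecidableEq ι] (H : Matrix ι ι ℝ) (t : ℝ)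
    (v : EuclideanSpace ℝ ι) : qf H (t • v) = t ^ 2 * qf H v := by
  simp only [qf, map_smul, real_inner_smul_left, real_inner_smul_right]
  ring

@[simp] theorem qf_zero {ι : Type*} [Fintype ι] [DecidableEq ι] (H : Matrix ι ι ℝ) :
    qf H 0 = 0 := by
  simp [qf]

theorem continuous_qf {ι : Type*} [Fintype ι] [DecidableEq ι] (H : Matrix ι ι ℝ) :
    Continuous (qf H) :=
  continuous_id.inner (LinearMap.continuous_of_finiteDimensional _)

theorem hasGradientAt_qf {ι : Type*} [Fintype ι] [DecidableEq ι] {H : Matrix ι ι ℝ}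
    (hH : H.IsHermitian) (x c : EuclideanSpace ℝ ι) :
    HasGradientAt (fun y => 1 / 2 * qf H (y - c)) (Matrix.toEuclideanLin H (x - c)) x := by
  have hs := Matrix.isSymmetric_toEuclideanLin_iff.mpr hH
  set T := LinearMap.toContinuousLinearMap (Matrix.toEuclideanLin H) with hT
  have h1 : HasFDerivAt (fun y : EuclideanSpace ℝ ι => y - c) (ContinuousLinearMap.id ℝ _) x :=
    (hasFDerivAt_id x).sub_const c
  have h2 : HasFDerivAt (fun y : EuclideanSpace ℝ ι => T (y - c)) T x :=
    T.hasFDerivAt.comp x h1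
  have h3 := (h1.inner ℝ h2).const_mul (1 / 2)
  rw [hasGradientAt_iff_hasFDerivAt]
  refine h3.congr_fderiv ?_
  ext w
  have : ⟪x - c, Matrix.toEuclideanLin H w⟫ = ⟪Matrix.toEuclideanLin H (x - c), w⟫ := (hs _ _).symm
  simp only [hT, _root_.smul_apply, ContinuousLinearMap.comp_apply,
    ContinuousLinearMap.prod_apply, fderivInnerCLM_apply, ContinuousLinearMap.id_apply,
    LinearMap.coe_toContinuousLinearMap', InnerProductSpace.toDual_apply_apply, this, smul_eq_mul]
  rw [real_inner_comm w]
  ring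

theorem HasGradientAt.add_prox {ι : Type*} [Fintype ι] [DecidableEq ι] {H : Matrix ι ι ℝ}
    (hH : H.IsHermitian) {F : EuclideanSpace ℝ ι → ℝ} {G x : EuclideanSpace ℝ ι}
    (hF : HasGradientAt F G x) (u b c : EuclideanSpace ℝ ι) (β : ℝ) :
    HasGradientAt (fun y => F y + ⟪u, y⟫ + β / 2 * ‖y - b‖ ^ 2 + 1 / 2 * qf H (y - c))
      (G + u + β • (x - b) + Matrix.toEuclideanLin H (x - c)) x := by
  have h1 : HasFDerivAt (fun y : EuclideanSpace ℝ ι => y - b) (ContinuousLinearMap.id ℝ _) x :=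
    (hasFDerivAt_id x).sub_const b
  have h2 := (h1.norm_sq).const_mul (β / 2)
  have h3 : HasFDerivAt (fun y : EuclideanSpace ℝ ι => ⟪u, y⟫) (innerSL ℝ u) x :=
    (innerSL ℝ u).hasFDerivAt
  have h4 := ((hF.hasFDerivAt.add h3).add h2).add (hasGradientAt_qf hH x c).hasFDerivAt
  rw [hasGradientAt_iff_hasFDerivAt]
  refine h4.congr_fderiv ?_
  ext w
  simp
  ring

theorem HasGradientAt.eq_zero_of_forall_le {ι : Type*} [Fintype ι]
    {F : EuclideanSpace ℝ ι → ℝ} {G x : EuclideanSpace ℝ ι}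
    (hF : HasGradientAt F G x) (hmin : ∀ y, F x ≤ F y) : G = 0 := by
  have h := IsLocalMin.hasFDerivAt_eq_zero (Filter.Eventually.of_forall hmin) hF.hasFDerivAt
  simpa using h

theorem convexOn_add_inner_add_norm_sq {ι : Type*} [Fintype ι]
    {F : EuclideanSpace ℝ ι → ℝ} (hF : ConvexOn ℝ Set.univ F) (u b : EuclideanSpace ℝ ι)
    {β : ℝ} (hβ : 0 ≤ β) :
    ConvexOn ℝ Set.univ fun y => F y + ⟪u, y⟫ + β / 2 * ‖y - b‖ ^ 2 := by
  have h1 : ConvexOn ℝ Set.univ fun y : EuclideanSpace ℝ ι => ⟪u, y⟫ :=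
    (innerSL ℝ u).toLinearMap.convexOn convex_univ
  have h2 : ConvexOn ℝ Set.univ fun y : EuclideanSpace ℝ ι => ‖y - b‖ ^ 2 := by
    have := (convexOn_univ_norm (E := EuclideanSpace ℝ ι)).translate_left (-b)
    simp only [Set.preimage_univ] at this
    have h3 := this.pow (fun _ _ => norm_nonneg _) 2
    simpa [Function.comp_def, sub_eq_add_neg, Pi.pow_def] using h3
  exact (hF.add h1).add (h2.smul (by positivity : 0 ≤ β / 2))

theorem ConvexOn.add_qf_le_of_prox_min {ι : Type*} [Fintype ι] [DecidableEq ι]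
    {H : Matrix ι ι ℝ} {F : EuclideanSpace ℝ ι → ℝ} (hF : ConvexOn ℝ Set.univ F)
    {x z : EuclideanSpace ℝ ι}
    (hmin : ∀ y, F z + 1 / 2 * qf H (z - x) ≤ F y + 1 / 2 * qf H (y - x)) :
    F z + qf H (z - x) ≤ F x := by
  have key : ∀ t ∈ Set.Ioc (0 : ℝ) 1, F z + (1 - t / 2) * qf H (z - x) ≤ F x := by
    rintro t ⟨h0, h1⟩
    have hm := hmin ((1 - t) • z + t • x)
    have hc := hF.2 (Set.mem_univ z) (Set.mem_univ x) (sub_nonneg.2 h1) h0.le (by ring)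
    have he : (1 - t) • z + t • x - x = (1 - t) • (z - x) := by module
    rw [he, qf_smul] at hm
    simp only [smul_eq_mul] at hc
    have : t * (F z + (1 - t / 2) * qf H (z - x)) ≤ t * F x := by linarith
    exact le_of_mul_le_mul_left this h0
  have ht : Filter.Tendsto (fun t : ℝ => F z + (1 - t / 2) * qf H (z - x)) (nhdsWithin 0 (Set.Ioi 0))
      (nhds (F z + (1 - 0 / 2) * qf H (z - x))) :=
    tendsto_nhdsWithin_of_tendsto_nhds (Continuous.tendsto (by fun_prop) 0)
  have := le_of_tendsto ht (Filter.eventually_of_mem (Ioc_mem_nhdsGT one_pos) key)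
  simpa using this

theorem projM_apply {n : ℕ} (p v : E4 n) (i : Fin n) (j : Fin 4) :
    projM p v (i, j) = v (i, j) - (∑ j' : Fin 4, p (i, j') * v (i, j')) * p (i, j) := rfl

theorem sum_mul_projM {n : ℕ} {p : E4 n} (hp : p ∈ Msph n) (v : E4 n) (i : Fin n) :
    ∑ j : Fin 4, p (i, j) * projM p v (i, j) = 0 := by
  have h := hp i
  simp only [projM_apply, mul_sub, Finset.sum_sub_distrib]
  rw [sub_eq_zero]
  calc _ = (∑ j' : Fin 4, p (i, j') * v (i, j')) * ∑ j : Fin 4, p (i, j) ^ 2 := by rw [h, mul_one]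
    _ = _ := by
      rw [Finset.mul_sum]
      exact Finset.sum_congr rfl fun j _ => by ring

theorem inner_projM_self {n : ℕ} {p : E4 n} (hp : p ∈ Msph n) (v : E4 n) :
    ⟪v, projM p v⟫ = ‖projM p v‖ ^ 2 := by
  rw [← real_inner_self_eq_norm_sq, ← sub_eq_zero, ← inner_sub_left]
  simp only [PiLp.inner_apply, Fintype.sum_prod_type]
  refine Finset.sum_eq_zero fun i _ => ?_
  have h := sum_mul_projM hp v i
  calc _ = (∑ j' : Fin 4, p (i, j') * v (i, j')) * ∑ j : Fin 4, p (i, j) * projM p v (i, j) := by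
        rw [Finset.mul_sum]
        refine Finset.sum_congr rfl fun j _ => ?_
        simp only [PiLp.sub_apply, RCLike.inner_apply, conj_trivial]
        rw [projM_apply p v]
        simp
        ring
    _ = 0 := by rw [h, mul_zero]

theorem projM_eq_zero_of_forall_le {n : ℕ} {F : E4 n → ℝ} {G p : E4 n} (hp : p ∈ Msph n)
    (hF : HasGradientAt F G p) (hmin : ∀ y ∈ Msph n, F p ≤ F y) : projM p G = 0 := by
  set v := projM p G with hv
  let s : Fin n → ℝ := fun i => ∑ j, v (i, j) ^ 2
  have hs : ∀ i, 0 ≤ s i := fun i => Finset.sum_nonneg fun j _ => sq_nonneg _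
  let c : ℝ → E4 n := fun t =>
    WithLp.toLp 2 fun ij => (p ij + t * v ij) / Real.sqrt (1 + t ^ 2 * s ij.1)
  have hpos : ∀ t i, 0 < 1 + t ^ 2 * s i := fun t i => by
    have := hs i
    positivity
  have hcM : ∀ t, c t ∈ Msph n := by
    intro t i
    have h1 : ∑ j : Fin 4, p (i, j) ^ 2 = 1 := hp i
    have h2 : ∑ j : Fin 4, p (i, j) * v (i, j) = 0 := sum_mul_projM hp G i
    calc ∑ j : Fin 4, c t (i, j) ^ 2
        = (∑ j : Fin 4, p (i, j) ^ 2 + 2 * t * ∑ j : Fin 4, p (i, j) * v (i, j) + t ^ 2 * s i)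
            / (1 + t ^ 2 * s i) := by
          simp only [c, div_pow, Real.sq_sqrt (hpos t i).le]
          rw [← Finset.sum_div]
          congr 1
          simp only [s, Finset.mul_sum, ← Finset.sum_add_distrib]
          exact Finset.sum_congr rfl fun j _ => by ring
      _ = 1 := by rw [h1, h2, mul_zero, add_zero, div_self (hpos t i).ne']
  have hc0 : c 0 = p := by
    ext ij
    simp [c]
  have hd : HasDerivAt c v 0 := by
    have hpi : HasDerivAt
        (fun (t : ℝ) (ij : Fin n × Fin 4) => (p ij + t * v ij) / Real.sqrt (1 + t ^ 2 * s ij.1))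
        (fun ij => v ij) 0 := by
      rw [hasDerivAt_pi]
      intro ij
      have h1 : HasDerivAt (fun t : ℝ => p ij + t * v ij) (v ij) 0 := by
        simpa using ((hasDerivAt_id (0 : ℝ)).mul_const (v ij)).const_add (p ij)
      have h2 : HasDerivAt (fun t : ℝ => 1 + t ^ 2 * s ij.1) 0 0 := by
        simpa using ((hasDerivAt_pow 2 (0 : ℝ)).mul_const (s ij.1)).const_add 1
      have h3 := h2.sqrt (by simp)
      exact (h1.div h3 (by simp)).congr_deriv (by simp)
    exact (PiLp.continuousLinearEquiv 2 ℝ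
      (fun _ : Fin n × Fin 4 => ℝ)).symm.hasFDerivAt.comp_hasDerivAt (0 : ℝ) hpi
  have hF' : HasFDerivAt F (InnerProductSpace.toDual ℝ _ G) (c 0) := by
    rw [hc0]
    exact hF.hasFDerivAt
  have hcomp := hF'.comp_hasDerivAt (0 : ℝ) hd
  have hz := IsLocalMin.hasDerivAt_eq_zero
    (Filter.Eventually.of_forall fun t => by
      simpa [hc0] using hmin _ (hcM t)) hcomp
  rw [InnerProductSpace.toDual_apply_apply, inner_projM_self hp] at hz
  simpa using hz

theorem summable_of_add_le_add {Φ d b : ℕ → ℝ} (h : ∀ k, Φ (k + 1) + d k ≤ Φ k + b k)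
    (hd : ∀ k, 0 ≤ d k) (hb : ∀ k, 0 ≤ b k) (hbs : Summable b) {C : ℝ} (hC : ∀ k, C ≤ Φ k) :
    Summable d := by
  refine summable_of_sum_range_le (c := Φ 0 + ∑' k, b k - C) hd fun N => ?_
  have h1 : ∀ N, Φ N + ∑ k ∈ Finset.range N, d k ≤ Φ 0 + ∑ k ∈ Finset.range N, b k := by
    intro N
    induction N with
    | zero => simp
    | succ N ih =>
      rw [Finset.sum_range_succ, Finset.sum_range_succ]
      linarith [h N]
  linarith [h1 N, hC N, hbs.sum_le_tsum (Finset.range N) fun i _ => hb i]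

theorem tendsto_zero_of_summable_norm_sq {E : Type*} [NormedAddCommGroup E] {u : ℕ → E}
    (h : Summable fun k => ‖u (k + 1)‖ ^ 2) : Filter.Tendsto u Filter.atTop (nhds 0) := by
  rw [← Filter.tendsto_add_atTop_iff_nat 1, tendsto_zero_iff_norm_tendsto_zero]
  have h1 := (Real.continuous_sqrt.tendsto _).comp h.tendsto_atTop_zero
  simpa [Function.comp_def] using h1

theorem sq_norm_relaxed_le {E : Type*} [NormedAddCommGroup E] [NormedSpace ℝ E]
    {τ β : ℝ} (hτ : τ ∈ Set.Ioo (0 : ℝ) 2) (hβ : 0 < β) (a b c : E)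
    (h : c = (1 - τ) • a - τ • b) :
    1 / (τ * β) * ‖c‖ ^ 2 + |1 - τ| / (1 - |1 - τ|) / (τ * β) * ‖c‖ ^ 2 ≤
      |1 - τ| / (1 - |1 - τ|) / (τ * β) * ‖a‖ ^ 2 + τ / (1 - |1 - τ|) ^ 2 / β * ‖b‖ ^ 2 := by
  obtain ⟨h0, h2⟩ := hτ
  have hq1 : |1 - τ| < 1 := abs_lt.2 ⟨by linarith, by linarith⟩
  have hn : ‖c‖ ≤ |1 - τ| * ‖a‖ + τ * ‖b‖ := by
    rw [h]
    refine (norm_sub_le _ _).trans_eq ?_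
    rw [norm_smul, norm_smul, Real.norm_eq_abs, Real.norm_eq_abs, abs_of_pos h0]
  have hq0 := abs_nonneg (1 - τ)
  generalize |1 - τ| = q at *
  have hs : 0 < 1 - q := by linarith
  have hsq : ‖c‖ ^ 2 ≤ q * ‖a‖ ^ 2 + τ ^ 2 / (1 - q) * ‖b‖ ^ 2 := by
    have h1 : ‖c‖ ^ 2 ≤ (q * ‖a‖ + τ * ‖b‖) ^ 2 := pow_le_pow_left₀ (norm_nonneg _) hn 2
    have h3 : q * ‖a‖ ^ 2 + τ ^ 2 / (1 - q) * ‖b‖ ^ 2 - (q * ‖a‖ + τ * ‖b‖) ^ 2 =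
        q / (1 - q) * ((1 - q) * ‖a‖ - τ * ‖b‖) ^ 2 := by
      field_simp
      ring
    have h4 : 0 ≤ q / (1 - q) * ((1 - q) * ‖a‖ - τ * ‖b‖) ^ 2 := by positivity
    linarith
  have hm := mul_le_mul_of_nonneg_left hsq (by positivity : 0 ≤ 1 / ((1 - q) * (τ * β)))
  calc _ = 1 / ((1 - q) * (τ * β)) * ‖c‖ ^ 2 := by
        field_simp
        ring
    _ ≤ _ := hm
    _ = _ := by
        field_simp

theorem norm_add_four_sq_le {E : Type*} [SeminormedAddCommGroup E] (a b c d : E) :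
    ‖a + b + c - d‖ ^ 2 ≤ 4 * (‖a‖ ^ 2 + ‖b‖ ^ 2 + ‖c‖ ^ 2 + ‖d‖ ^ 2) := by
  have h : ‖a + b + c - d‖ ≤ ‖a‖ + ‖b‖ + ‖c‖ + ‖d‖ :=
    (norm_sub_le _ _).trans (add_le_add_left norm_add₃_le _)
  have h1 := pow_le_pow_left₀ (norm_nonneg _) h 2
  nlinarith [sq_nonneg (‖a‖ - ‖b‖), sq_nonneg (‖a‖ - ‖c‖), sq_nonneg (‖a‖ - ‖d‖),
    sq_nonneg (‖b‖ - ‖c‖), sq_nonneg (‖b‖ - ‖d‖), sq_nonneg (‖c‖ - ‖d‖)]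

theorem norm_add_three_sq_le {E : Type*} [SeminormedAddCommGroup E] (a b c : E) :
    ‖a + b - c‖ ^ 2 ≤ 3 * (‖a‖ ^ 2 + ‖b‖ ^ 2 + ‖c‖ ^ 2) := by
  have h : ‖a + b - c‖ ≤ ‖a‖ + ‖b‖ + ‖c‖ :=
    (norm_sub_le _ _).trans (add_le_add_left (norm_add_le _ _) _)
  have h1 := pow_le_pow_left₀ (norm_nonneg _) h 2
  nlinarith [sq_nonneg (‖a‖ - ‖b‖), sq_nonneg (‖a‖ - ‖c‖), sq_nonneg (‖b‖ - ‖c‖)]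

theorem le_sq_mul_of_sqrt_le {A B L : ℝ} (hA : 0 ≤ A) (hB : 0 ≤ B)
    (h : Real.sqrt A ≤ L * Real.sqrt B) : A ≤ L ^ 2 * B := by
  have := pow_le_pow_left₀ (Real.sqrt_nonneg _) h 2
  rwa [mul_pow, Real.sq_sqrt hA, Real.sq_sqrt hB] at this

theorem isClosed_Msph (n : ℕ) : IsClosed (Msph n) := by
  simp only [Msph, Set.ofPred_forall]
  exact isClosed_iInter fun i => isClosed_eq (by fun_prop) continuous_const

theorem augL_eq_first {n : ℕ} (f : E4 n → E4 n → E3 n → E3 n → ℝ) (g : E4 n → E4 n → ℝ)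
    (β : ℝ) (x1 x2 : E4 n) (x3 x4 : E3 n) (l1 : E4 n) (l2 : E3 n) :
    augL f g β x1 x2 x3 x4 l1 l2 =
      (f x1 x2 x3 x4 + g x1 x2) + ⟪-l1, x1⟫ + β / 2 * ‖x1 - x2‖ ^ 2 +
        (⟪l1, x2⟫ - ⟪l2, x3 - x4⟫ + β / 2 * ‖x3 - x4‖ ^ 2) := by
  simp only [augL, inner_sub_right, inner_neg_left]
  ring

theorem augL_eq_second {n : ℕ} (f : E4 n → E4 n → E3 n → E3 n → ℝ) (g : E4 n → E4 n → ℝ)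
    (β : ℝ) (x1 x2 : E4 n) (x3 x4 : E3 n) (l1 : E4 n) (l2 : E3 n) :
    augL f g β x1 x2 x3 x4 l1 l2 =
      (f x1 x2 x3 x4 + g x1 x2) + ⟪l1, x2⟫ + β / 2 * ‖x2 - x1‖ ^ 2 +
        (-⟪l1, x1⟫ - ⟪l2, x3 - x4⟫ + β / 2 * ‖x3 - x4‖ ^ 2) := by
  simp only [augL, inner_sub_right, norm_sub_rev x2 x1]
  ring

theorem augL_eq_third {n : ℕ} (f : E4 n → E4 n → E3 n → E3 n → ℝ) (g : E4 n → E4 n → ℝ)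
    (β : ℝ) (x1 x2 : E4 n) (x3 x4 : E3 n) (l1 : E4 n) (l2 : E3 n) :
    augL f g β x1 x2 x3 x4 l1 l2 =
      f x1 x2 x3 x4 + ⟪-l2, x3⟫ + β / 2 * ‖x3 - x4‖ ^ 2 +
        (g x1 x2 + ⟪l2, x4⟫ - ⟪l1, x1 - x2⟫ + β / 2 * ‖x1 - x2‖ ^ 2) := by
  simp only [augL, inner_sub_right, inner_neg_left]
  ring

theorem augL_eq_fourth {n : ℕ} (f : E4 n → E4 n → E3 n → E3 n → ℝ) (g : E4 n → E4 n → ℝ)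
    (β : ℝ) (x1 x2 : E4 n) (x3 x4 : E3 n) (l1 : E4 n) (l2 : E3 n) :
    augL f g β x1 x2 x3 x4 l1 l2 =
      f x1 x2 x3 x4 + ⟪l2, x4⟫ + β / 2 * ‖x4 - x3‖ ^ 2 +
        (g x1 x2 - ⟪l2, x3⟫ - ⟪l1, x1 - x2⟫ + β / 2 * ‖x1 - x2‖ ^ 2) := by
  simp only [augL, inner_sub_right, norm_sub_rev x4 x3]
  ring

theorem continuous_augL {n : ℕ} {f : E4 n → E4 n → E3 n → E3 n → ℝ} {g : E4 n → E4 n → ℝ}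
    (hf : Continuous fun p : (E4 n × E4 n) × E3 n × E3 n => f p.1.1 p.1.2 p.2.1 p.2.2)
    (hg : Continuous fun p : E4 n × E4 n => g p.1 p.2) (β : ℝ) :
    Continuous fun p : ((E4 n × E4 n) × E3 n × E3 n) × E4 n × E3 n =>
      augL f g β p.1.1.1 p.1.1.2 p.1.2.1 p.1.2.2 p.2.1 p.2.2 := by
  have h1 := hf.comp (continuous_fst (Y := E4 n × E3 n))
  have h2 := hg.comp (continuous_fst.comp
    (continuous_fst (X := (E4 n × E4 n) × E3 n × E3 n) (Y := E4 n × E3 n)))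
  simp only [Function.comp_def] at h1 h2
  exact (((h1.add h2).sub (by fun_prop)).sub (by fun_prop)).add (by fun_prop)

theorem tendsto_augL {n : ℕ} {f : E4 n → E4 n → E3 n → E3 n → ℝ} {g : E4 n → E4 n → ℝ}
    (hf : Continuous fun p : (E4 n × E4 n) × E3 n × E3 n => f p.1.1 p.1.2 p.2.1 p.2.2)
    (hg : Continuous fun p : E4 n × E4 n => g p.1 p.2) (β : ℝ) {a b l : ℕ → E4 n}
    {c d m : ℕ → E3 n} {a' b' l' : E4 n} {c' d' m' : E3 n}
    (ha : Filter.Tendsto a Filter.atTop (nhds a')) (hb : Filter.Tendsto b Filter.atTop (nhds b'))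
    (hc : Filter.Tendsto c Filter.atTop (nhds c')) (hd : Filter.Tendsto d Filter.atTop (nhds d'))
    (hl : Filter.Tendsto l Filter.atTop (nhds l')) (hm : Filter.Tendsto m Filter.atTop (nhds m')) :
    Filter.Tendsto (fun k => augL f g β (a k) (b k) (c k) (d k) (l k) (m k)) Filter.atTop
      (nhds (augL f g β a' b' c' d' l' m')) :=
  ((continuous_augL hf hg β).tendsto (((a', b'), c', d'), l', m')).comp
    (((ha.prodMk_nhds hb).prodMk_nhds (hc.prodMk_nhds hd)).prodMk_nhds (hl.prodMk_nhds hm))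

theorem exists_le_augL {n : ℕ} {f : E4 n → E4 n → E3 n → E3 n → ℝ} {g : E4 n → E4 n → ℝ}
    (hf : Continuous fun p : (E4 n × E4 n) × E3 n × E3 n => f p.1.1 p.1.2 p.2.1 p.2.2)
    (hg : Continuous fun p : E4 n × E4 n => g p.1 p.2) (β R : ℝ) :
    ∃ C, ∀ (a b : E4 n) (c d : E3 n) (l : E4 n) (m : E3 n), ‖a‖ ≤ R → ‖b‖ ≤ R → ‖c‖ ≤ R →
      ‖d‖ ≤ R → ‖l‖ ≤ R → ‖m‖ ≤ R → C ≤ augL f g β a b c d l m := by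
  obtain ⟨C, hC⟩ := (isCompact_closedBall
    (0 : ((E4 n × E4 n) × E3 n × E3 n) × E4 n × E3 n) R).exists_bound_of_continuousOn
      (continuous_augL hf hg β).continuousOn
  refine ⟨-C, fun a b c d l m ha hb hc hd hl hm => ?_⟩
  have := hC (((a, b), c, d), l, m) (by simp [Prod.norm_def, *])
  exact (abs_le.1 this).1

theorem augL_dual_update {n : ℕ} (f : E4 n → E4 n → E3 n → E3 n → ℝ) (g : E4 n → E4 n → ℝ)
    {β τ : ℝ} (hτβ : τ * β ≠ 0) (x1 x2 : E4 n) (x3 x4 : E3 n) (l1 l1' : E4 n)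
    (l2 l2' : E3 n) (h1 : l1' = l1 - (τ * β) • (x1 - x2)) (h2 : l2' = l2 - (τ * β) • (x3 - x4)) :
    augL f g β x1 x2 x3 x4 l1' l2' =
      augL f g β x1 x2 x3 x4 l1 l2 + 1 / (τ * β) * (‖l1' - l1‖ ^ 2 + ‖l2' - l2‖ ^ 2) := by
  have e1 : l1' - l1 = (-(τ * β)) • (x1 - x2) := by rw [h1]; module
  have e2 : l2' - l2 = (-(τ * β)) • (x3 - x4) := by rw [h2]; module
  rw [e1, e2, norm_smul, norm_smul, mul_pow, mul_pow, Real.norm_eq_abs, sq_abs, h1, h2]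
  rw [augL, augL, inner_sub_left l1, inner_sub_left l2, real_inner_smul_left,
    real_inner_smul_left, real_inner_self_eq_norm_sq, real_inner_self_eq_norm_sq]
  field_simp
  ring

theorem hasGradientAt_blocks {n : ℕ} {f : E4 n → E4 n → E3 n → E3 n → ℝ}
    (hf : ContDiff ℝ 1 fun p : (E4 n × E4 n) × E3 n × E3 n => f p.1.1 p.1.2 p.2.1 p.2.2)
    (a b : E4 n) (c d : E3 n) :
    HasGradientAt (fun y => f y b c d) (grad1f f a b c d) a ∧
      HasGradientAt (fun y => f a y c d) (grad2f f a b c d) b ∧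
      HasGradientAt (fun y => f a b y d) (grad3f f a b c d) c ∧
      HasGradientAt (fun y => f a b c y) (grad4f f a b c d) d := by
  have hd := hf.differentiable one_ne_zero
  refine ⟨DifferentiableAt.hasGradientAt ?_, DifferentiableAt.hasGradientAt ?_,
    DifferentiableAt.hasGradientAt ?_, DifferentiableAt.hasGradientAt ?_⟩
  · exact (hd.comp (by fun_prop : Differentiable ℝ fun y : E4 n => ((y, b), c, d))) a
  · exact (hd.comp (by fun_prop : Differentiable ℝ fun y : E4 n => ((a, y), c, d))) b
  · exact (hd.comp (by fun_prop : Differentiable ℝ fun y : E3 n => ((a, b), y, d))) c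
  · exact (hd.comp (by fun_prop : Differentiable ℝ fun y : E3 n => ((a, b), c, y))) d

theorem hasGradientAt_pair {n : ℕ} {g : E4 n → E4 n → ℝ}
    (hg : ContDiff ℝ 1 fun p : E4 n × E4 n => g p.1 p.2) (a b : E4 n) :
    HasGradientAt (fun y => g y b) (grad1g g a b) a ∧
      HasGradientAt (fun y => g a y) (grad2g g a b) b := by
  have hd := hg.differentiable one_ne_zero
  refine ⟨DifferentiableAt.hasGradientAt ?_, DifferentiableAt.hasGradientAt ?_⟩
  · exact (hd.comp (by fun_prop : Differentiable ℝ fun y : E4 n => (y, b))) a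
  · exact (hd.comp (by fun_prop : Differentiable ℝ fun y : E4 n => (a, y))) b

theorem HasGradientAt.add_fun {ι : Type*} [Fintype ι] {F K : EuclideanSpace ℝ ι → ℝ}
    {G G' x : EuclideanSpace ℝ ι} (hF : HasGradientAt F G x) (hK : HasGradientAt K G' x) :
    HasGradientAt (fun y => F y + K y) (G + G') x := by
  rw [hasGradientAt_iff_hasFDerivAt, map_add]
  exact hF.hasFDerivAt.add hK.hasFDerivAt

theorem projM_eq_zero_of_augL_min {n : ℕ} {f : E4 n → E4 n → E3 n → E3 n → ℝ}
    {g : E4 n → E4 n → ℝ}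
    (hf : ContDiff ℝ 1 fun p : (E4 n × E4 n) × E3 n × E3 n => f p.1.1 p.1.2 p.2.1 p.2.2)
    (hg : ContDiff ℝ 1 fun p : E4 n × E4 n => g p.1 p.2) (β : ℝ)
    {H : Matrix (Fin n × Fin 4) (Fin n × Fin 4) ℝ} (hH : H.IsHermitian)
    {a a' b : E4 n} {c d : E3 n} {l1 : E4 n} {l2 : E3 n} (ha' : a' ∈ Msph n)
    (hmin : ∀ y ∈ Msph n, augL f g β a' b c d l1 l2 + 1 / 2 * qf H (a' - a) ≤
      augL f g β y b c d l1 l2 + 1 / 2 * qf H (y - a)) :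
    projM a' (grad1f f a' b c d + grad1g g a' b + -l1 + β • (a' - b) +
      Matrix.toEuclideanLin H (a' - a)) = 0 := by
  have hG := ((hasGradientAt_blocks hf a' b c d).1.add_fun
    (hasGradientAt_pair hg a' b).1).add_prox hH (-l1) b a β
  refine projM_eq_zero_of_forall_le ha' hG fun y hy => ?_
  have := hmin y hy
  rw [augL_eq_first, augL_eq_first] at this
  linarith

theorem second_block_prox_step {n : ℕ} {f : E4 n → E4 n → E3 n → E3 n → ℝ}
    {g : E4 n → E4 n → ℝ}
    (hf : ContDiff ℝ 1 fun p : (E4 n × E4 n) × E3 n × E3 n => f p.1.1 p.1.2 p.2.1 p.2.2)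
    (hg : ContDiff ℝ 1 fun p : E4 n × E4 n => g p.1 p.2)
    (hfc : ∀ (a : E4 n) (c d : E3 n), ConvexOn ℝ Set.univ fun y => f a y c d)
    (hgc : ∀ a : E4 n, ConvexOn ℝ Set.univ fun y => g a y) {β : ℝ} (hβ : 0 < β)
    {H : Matrix (Fin n × Fin 4) (Fin n × Fin 4) ℝ} (hH : H.IsHermitian)
    {a b b' : E4 n} {c d : E3 n} {l1 : E4 n} {l2 : E3 n}
    (hmin : ∀ y, augL f g β a b' c d l1 l2 + 1 / 2 * qf H (b' - b) ≤
      augL f g β a y c d l1 l2 + 1 / 2 * qf H (y - b)) :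
    grad2f f a b' c d + grad2g g a b' + l1 + β • (b' - a) + Matrix.toEuclideanLin H (b' - b) = 0 ∧
      augL f g β a b' c d l1 l2 + qf H (b' - b) ≤ augL f g β a b c d l1 l2 := by
  simp only [augL_eq_second f g β a _ c d] at hmin ⊢
  constructor
  · refine (((hasGradientAt_blocks hf a b' c d).2.1.add_fun
      (hasGradientAt_pair hg a b').2).add_prox hH l1 a b β).eq_zero_of_forall_le fun y => ?_
    linarith [hmin y]
  · have := (convexOn_add_inner_add_norm_sq ((hfc a c d).add (hgc a)) l1 a hβ.le).add_qf_le_of_prox_min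
      (H := H) (x := b) (z := b') fun y => by
        simp only [Pi.add_apply]
        linarith [hmin y]
    simp only [Pi.add_apply] at this
    linarith

theorem third_block_prox_step {n : ℕ} {f : E4 n → E4 n → E3 n → E3 n → ℝ}
    {g : E4 n → E4 n → ℝ}
    (hf : ContDiff ℝ 1 fun p : (E4 n × E4 n) × E3 n × E3 n => f p.1.1 p.1.2 p.2.1 p.2.2)
    (hfc : ∀ (a b : E4 n) (d : E3 n), ConvexOn ℝ Set.univ fun y => f a b y d)
    {β : ℝ} (hβ : 0 < β)
    {H : Matrix (Fin n × Fin 3) (Fin n × Fin 3) ℝ} (hH : H.IsHermitian)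
    {a b : E4 n} {c c' d : E3 n} {l1 : E4 n} {l2 : E3 n}
    (hmin : ∀ y, augL f g β a b c' d l1 l2 + 1 / 2 * qf H (c' - c) ≤
      augL f g β a b y d l1 l2 + 1 / 2 * qf H (y - c)) :
    grad3f f a b c' d + -l2 + β • (c' - d) + Matrix.toEuclideanLin H (c' - c) = 0 ∧
      augL f g β a b c' d l1 l2 + qf H (c' - c) ≤ augL f g β a b c d l1 l2 := by
  simp only [augL_eq_third f g β a b _ d] at hmin ⊢
  constructor
  · refine ((hasGradientAt_blocks hf a b c' d).2.2.1.add_prox hH (-l2) d c β).eq_zero_of_forall_le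
      fun y => ?_
    linarith [hmin y]
  · have := (convexOn_add_inner_add_norm_sq (hfc a b d) (-l2) d hβ.le).add_qf_le_of_prox_min
      (H := H) (x := c) (z := c') fun y => by linarith [hmin y]
    linarith

theorem fourth_block_prox_step {n : ℕ} {f : E4 n → E4 n → E3 n → E3 n → ℝ}
    {g : E4 n → E4 n → ℝ}
    (hf : ContDiff ℝ 1 fun p : (E4 n × E4 n) × E3 n × E3 n => f p.1.1 p.1.2 p.2.1 p.2.2)
    (hfc : ∀ (a b : E4 n) (c : E3 n), ConvexOn ℝ Set.univ fun y => f a b c y)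
    {β : ℝ} (hβ : 0 < β)
    {H : Matrix (Fin n × Fin 3) (Fin n × Fin 3) ℝ} (hH : H.IsHermitian)
    {a b : E4 n} {c d d' : E3 n} {l1 : E4 n} {l2 : E3 n}
    (hmin : ∀ y, augL f g β a b c d' l1 l2 + 1 / 2 * qf H (d' - d) ≤
      augL f g β a b c y l1 l2 + 1 / 2 * qf H (y - d)) :
    grad4f f a b c d' + l2 + β • (d' - c) + Matrix.toEuclideanLin H (d' - d) = 0 ∧
      augL f g β a b c d' l1 l2 + qf H (d' - d) ≤ augL f g β a b c d l1 l2 := by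
  simp only [augL_eq_fourth f g β a b c _] at hmin ⊢
  constructor
  · refine ((hasGradientAt_blocks hf a b c d').2.2.2.add_prox hH l2 c d β).eq_zero_of_forall_le
      fun y => ?_
    linarith [hmin y]
  · have := (convexOn_add_inner_add_norm_sq (hfc a b c) l2 c hβ.le).add_qf_le_of_prox_min
      (H := H) (x := d) (z := d') fun y => by linarith [hmin y]
    linarith

theorem dual_eq_relaxed {E : Type*} [AddCommGroup E] [Module ℝ E] {β τ : ℝ}
    {l l' G x z t : E} (hopt : G + l + β • (x - z) + t = 0)
    (hl : l' = l - (τ * β) • (z - x)) : l' = (1 - τ) • l - τ • (G + t) := by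
  have h : G + t = -l - β • (x - z) := by
    rw [← sub_eq_zero, ← hopt]
    abel
  rw [hl, h]
  module

theorem relaxed_sub_relaxed {E : Type*} [AddCommGroup E] [Module ℝ E] {τ : ℝ}
    {l l' l'' w w' : E} (h' : l'' = (1 - τ) • l' - τ • w') (h : l' = (1 - τ) • l - τ • w) :
    l'' - l' = (1 - τ) • (l' - l) - τ • (w' - w) := by
  calc l'' - l' = ((1 - τ) • l' - τ • w') - ((1 - τ) • l - τ • w) := by rw [← h', ← h]
    _ = _ := by module

theorem tendsto_succ_of_tendsto_sub {E : Type*} [SeminormedAddCommGroup E] {x : ℕ → E} {y : E}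
    {φ : ℕ → ℕ} (hφ : Filter.Tendsto φ Filter.atTop Filter.atTop)
    (hD : Filter.Tendsto (fun k => x (k + 1) - x k) Filter.atTop (nhds 0))
    (hy : Filter.Tendsto (fun j => x (φ j)) Filter.atTop (nhds y)) :
    Filter.Tendsto (fun j => x (φ j + 1)) Filter.atTop (nhds y) := by
  simpa [Function.comp_def] using (hD.comp hφ).add hy

theorem eq_of_tendsto_dual {E : Type*} [NormedAddCommGroup E] [NormedSpace ℝ E] {r : ℝ}
    (hr : r ≠ 0) {l x z : ℕ → E} {y y' : E}
    {φ : ℕ → ℕ} (hφ : Filter.Tendsto φ Filter.atTop Filter.atTop)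
    (hD : Filter.Tendsto (fun k => l (k + 1) - l k) Filter.atTop (nhds 0))
    (hl : ∀ k, l (k + 1) = l k - r • (x (k + 1) - z (k + 1)))
    (hx : Filter.Tendsto (fun j => x (φ j + 1)) Filter.atTop (nhds y))
    (hz : Filter.Tendsto (fun j => z (φ j + 1)) Filter.atTop (nhds y')) : y = y' := by
  have h1 := ((hx.sub hz).const_smul r).neg
  have h2 : Filter.Tendsto (fun j => -(r • (x (φ j + 1) - z (φ j + 1)))) Filter.atTop (nhds 0) := by
    refine (hD.comp hφ).congr fun j => ?_
    simp only [Function.comp_apply, hl]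
    abel
  have h := tendsto_nhds_unique h1 h2
  rw [neg_eq_zero, smul_eq_zero] at h
  exact sub_eq_zero.1 (h.resolve_left hr)

/-- Theorem 5.2(ii)-(iii): the successive differences of the iterates tend to `0`, and
every limit point of the sequence is a stationary point of `L_β`. -/
theorem stmt18 (n : ℕ)
    (f : E4 n → E4 n → E3 n → E3 n → ℝ) (g : E4 n → E4 n → ℝ)
    (hf : ContDiff ℝ 1 fun p : (E4 n × E4 n) × E3 n × E3 n => f p.1.1 p.1.2 p.2.1 p.2.2)
    (hg : ContDiff ℝ 1 fun p : E4 n × E4 n => g p.1 p.2)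
    (Lf Lg : ℝ) (hLf : 0 < Lf) (hLg : 0 < Lg)
    (hfLip : ∀ a b : E4 n, ∀ c d : E3 n, ∀ a' b' : E4 n, ∀ c' d' : E3 n,
        Real.sqrt (‖grad1f f a b c d - grad1f f a' b' c' d'‖ ^ 2 +
            ‖grad2f f a b c d - grad2f f a' b' c' d'‖ ^ 2 +
            ‖grad3f f a b c d - grad3f f a' b' c' d'‖ ^ 2 +
            ‖grad4f f a b c d - grad4f f a' b' c' d'‖ ^ 2) ≤
          Lf * Real.sqrt (‖a - a'‖ ^ 2 + ‖b - b'‖ ^ 2 + ‖c - c'‖ ^ 2 + ‖d - d'‖ ^ 2))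
    (hgLip : ∀ a b a' b' : E4 n,
        Real.sqrt (‖grad1g g a b - grad1g g a' b'‖ ^ 2 +
            ‖grad2g g a b - grad2g g a' b'‖ ^ 2) ≤
          Lg * Real.sqrt (‖a - a'‖ ^ 2 + ‖b - b'‖ ^ 2))
    (hfconv1 : ∀ (b : E4 n) (c d : E3 n), ConvexOn ℝ Set.univ fun y => f y b c d)
    (hfconv2 : ∀ (a : E4 n) (c d : E3 n), ConvexOn ℝ Set.univ fun y => f a y c d)
    (hfconv3 : ∀ (a b : E4 n) (d : E3 n), ConvexOn ℝ Set.univ fun y => f a b y d)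
    (hfconv4 : ∀ (a b : E4 n) (c : E3 n), ConvexOn ℝ Set.univ fun y => f a b c y)
    (hgconv1 : ∀ b : E4 n, ConvexOn ℝ Set.univ fun y => g y b)
    (hgconv2 : ∀ a : E4 n, ConvexOn ℝ Set.univ fun y => g a y)
    (β τ : ℝ) (hβ : 0 < β) (hτ : τ ∈ Set.Ioo (0 : ℝ) 2)
    (H1 H2 : Matrix (Fin n × Fin 4) (Fin n × Fin 4) ℝ)
    (H3 H4 : Matrix (Fin n × Fin 3) (Fin n × Fin 3) ℝ)
    (hH1 : H1.PosDef) (hH2 : H2.PosDef) (hH3 : H3.PosDef) (hH4 : H4.PosDef)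
    (x1 x2 : ℕ → E4 n) (x3 x4 : ℕ → E3 n)
    (l1 : ℕ → E4 n) (l2 : ℕ → E3 n)
    (hbdd : ∃ R : ℝ, ∀ k, ‖x1 k‖ ≤ R ∧ ‖x2 k‖ ≤ R ∧ ‖x3 k‖ ≤ R ∧ ‖x4 k‖ ≤ R ∧
        ‖l1 k‖ ≤ R ∧ ‖l2 k‖ ≤ R)
    (hx1M : ∀ k, x1 k ∈ Msph n)
    (hmin1 : ∀ k, ∀ y ∈ Msph n,
        augL f g β (x1 (k + 1)) (x2 k) (x3 k) (x4 k) (l1 k) (l2 k) +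
            1 / 2 * qf H1 (x1 (k + 1) - x1 k) ≤
          augL f g β y (x2 k) (x3 k) (x4 k) (l1 k) (l2 k) + 1 / 2 * qf H1 (y - x1 k))
    (hmin2 : ∀ k, ∀ y : E4 n,
        augL f g β (x1 (k + 1)) (x2 (k + 1)) (x3 k) (x4 k) (l1 k) (l2 k) +
            1 / 2 * qf H2 (x2 (k + 1) - x2 k) ≤
          augL f g β (x1 (k + 1)) y (x3 k) (x4 k) (l1 k) (l2 k) + 1 / 2 * qf H2 (y - x2 k))
    (hmin3 : ∀ k, ∀ y : E3 n,
        augL f g β (x1 (k + 1)) (x2 (k + 1)) (x3 (k + 1)) (x4 k) (l1 k) (l2 k) +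
            1 / 2 * qf H3 (x3 (k + 1) - x3 k) ≤
          augL f g β (x1 (k + 1)) (x2 (k + 1)) y (x4 k) (l1 k) (l2 k) +
            1 / 2 * qf H3 (y - x3 k))
    (hmin4 : ∀ k, ∀ y : E3 n,
        augL f g β (x1 (k + 1)) (x2 (k + 1)) (x3 (k + 1)) (x4 (k + 1)) (l1 k) (l2 k) +
            1 / 2 * qf H4 (x4 (k + 1) - x4 k) ≤
          augL f g β (x1 (k + 1)) (x2 (k + 1)) (x3 (k + 1)) y (l1 k) (l2 k) +
            1 / 2 * qf H4 (y - x4 k))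
    (hdual1 : ∀ k, l1 (k + 1) = l1 k - (τ * β) • (x1 (k + 1) - x2 (k + 1)))
    (hdual2 : ∀ k, l2 (k + 1) = l2 k - (τ * β) • (x3 (k + 1) - x4 (k + 1)))
    (α1 α2 : ℝ)
    (hα1 : α1 = |1 - τ| / (1 - |1 - τ|))
    (hα2 : α2 = τ / (1 - |1 - τ|) ^ 2)
    (Lg2 : ℝ) (hLg2 : 0 < Lg2)
    (hg2Lip : ∀ a b b' : E4 n, ‖grad2g g a b - grad2g g a b'‖ ≤ Lg2 * ‖b - b'‖)
    (fstar gstar : ℝ)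
    (hfstar : IsGLB {r : ℝ | ∃ y1 ∈ Msph n, ∃ (y2 : E4 n) (y3 y4 : E3 n),
        r = f y1 y2 y3 y4} fstar)
    (hgstar : IsGLB {r : ℝ | ∃ y1 ∈ Msph n, ∃ y2 : E4 n, r = g y1 y2} gstar)
    (k1lo k2lo k2hi k3lo k4lo k4hi : ℝ)
    (hk1lo : IsLeast {μ : ℝ | ∃ v : (Fin n × Fin 4) → ℝ, v ≠ 0 ∧ H1 *ᵥ v = μ • v} k1lo)
    (hk2lo : IsLeast {μ : ℝ | ∃ v : (Fin n × Fin 4) → ℝ, v ≠ 0 ∧ H2 *ᵥ v = μ • v} k2lo)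
    (hk2hi : IsGreatest {μ : ℝ | ∃ v : (Fin n × Fin 4) → ℝ, v ≠ 0 ∧ H2 *ᵥ v = μ • v} k2hi)
    (hk3lo : IsLeast {μ : ℝ | ∃ v : (Fin n × Fin 3) → ℝ, v ≠ 0 ∧ H3 *ᵥ v = μ • v} k3lo)
    (hk4lo : IsLeast {μ : ℝ | ∃ v : (Fin n × Fin 3) → ℝ, v ≠ 0 ∧ H4 *ᵥ v = μ • v} k4lo)
    (hk4hi : IsGreatest {μ : ℝ | ∃ v : (Fin n × Fin 3) → ℝ, v ≠ 0 ∧ H4 *ᵥ v = μ • v} k4hi)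
    (βone : ℝ)
    (hβone : βone = max (2 * (Lf + Lg2)) (max (2 * α2 / k1lo * (7 * Lf ^ 2 + 4 * Lg ^ 2))
        (max (α2 / k2lo * (7 * Lf ^ 2 + 4 * Lg ^ 2) + (4 * α2 + 2) * k2hi ^ 2 / k2lo)
          (max ((3 * α2 + 2) / k3lo * Lf ^ 2)
            ((3 * α2 + 2) / k4lo * Lf ^ 2 + (3 * α2 + 1) * k4hi ^ 2 / k4lo)))))
    (βtwo : ℝ)
    (hβtwo : βtwo = max (2 * α2 / k1lo * (7 * Lf ^ 2 + 4 * Lg ^ 2))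
        (max (α2 / k2lo * (7 * Lf ^ 2 + 4 * Lg ^ 2 + 8 * k2hi ^ 2))
          (max (7 * α2 * Lf ^ 2 / k3lo) (α2 / k4lo * (7 * Lf ^ 2 + 6 * k4hi ^ 2)))))
    (hβgt : β > max βone βtwo) :
    (Filter.Tendsto (fun k => x1 (k + 1) - x1 k) Filter.atTop (nhds 0) ∧
      Filter.Tendsto (fun k => x2 (k + 1) - x2 k) Filter.atTop (nhds 0) ∧
      Filter.Tendsto (fun k => x3 (k + 1) - x3 k) Filter.atTop (nhds 0) ∧
      Filter.Tendsto (fun k => x4 (k + 1) - x4 k) Filter.atTop (nhds 0) ∧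
      Filter.Tendsto (fun k => l1 (k + 1) - l1 k) Filter.atTop (nhds 0) ∧
      Filter.Tendsto (fun k => l2 (k + 1) - l2 k) Filter.atTop (nhds 0)) ∧
    ∀ (y1 y2 : E4 n) (y3 y4 : E3 n) (m1 : E4 n) (m2 : E3 n),
      (∃ φ : ℕ → ℕ, StrictMono φ ∧
        Filter.Tendsto (fun j => x1 (φ j)) Filter.atTop (nhds y1) ∧
        Filter.Tendsto (fun j => x2 (φ j)) Filter.atTop (nhds y2) ∧
        Filter.Tendsto (fun j => x3 (φ j)) Filter.atTop (nhds y3) ∧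
        Filter.Tendsto (fun j => x4 (φ j)) Filter.atTop (nhds y4) ∧
        Filter.Tendsto (fun j => l1 (φ j)) Filter.atTop (nhds m1) ∧
        Filter.Tendsto (fun j => l2 (φ j)) Filter.atTop (nhds m2)) →
      y1 ∈ Msph n ∧ y1 = y2 ∧ y3 = y4 ∧
        projM y1 (grad1f f y1 y2 y3 y4 + grad1g g y1 y2 - m1) = 0 ∧
        grad2f f y1 y2 y3 y4 + grad2g g y1 y2 + m1 = 0 ∧
        grad3f f y1 y2 y3 y4 = m2 ∧
        grad4f f y1 y2 y3 y4 = -m2 := by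
  obtain ⟨hτ0, hτ2⟩ := id hτ
  have hτβ : 0 < τ * β := mul_pos hτ0 hβ
  have hq1 : |1 - τ| < 1 := abs_lt.2 ⟨by linarith, by linarith⟩
  have hα1n : 0 ≤ α1 := by
    rw [hα1]
    exact div_nonneg (abs_nonneg _) (by linarith)
  have hα2p : 0 < α2 := by
    rw [hα2]
    exact div_pos hτ0 (pow_pos (by linarith) 2)
  have hk1 := eigenvalue_pos_of_posDef hH1 hk1lo.1
  have hk2 := eigenvalue_pos_of_posDef hH2 hk2lo.1
  have hk3 := eigenvalue_pos_of_posDef hH3 hk3lo.1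
  have hk4 := eigenvalue_pos_of_posDef hH4 hk4lo.1
  have opt2 := fun k =>
    second_block_prox_step hf hg hfconv2 hgconv2 hβ hH2.1 (hmin2 k)
  have opt3 := fun k => third_block_prox_step hf hfconv3 hβ hH3.1 (hmin3 k)
  have opt4 := fun k => fourth_block_prox_step hf hfconv4 hβ hH4.1 (hmin4 k)
  set E := α2 / β with hE
  have hEn : 0 < E := div_pos hα2p hβ
  obtain ⟨c1, hc1⟩ : ∃ c, c = k1lo / 2 - E * (7 * Lf ^ 2 + 4 * Lg ^ 2) := ⟨_, rfl⟩
  obtain ⟨c2, hc2⟩ : ∃ c, c = k2lo - E * (7 * Lf ^ 2 + 4 * Lg ^ 2 + 8 * k2hi ^ 2) := ⟨_, rfl⟩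
  obtain ⟨c3, hc3⟩ : ∃ c, c = k3lo - E * (7 * Lf ^ 2) := ⟨_, rfl⟩
  obtain ⟨c4, hc4⟩ : ∃ c, c = k4lo - E * (7 * Lf ^ 2 + 6 * k4hi ^ 2) := ⟨_, rfl⟩
  have hβtwo_lt : βtwo < β := (le_max_right _ _).trans_lt hβgt
  rw [hβtwo, max_lt_iff, max_lt_iff, max_lt_iff] at hβtwo_lt
  obtain ⟨hb1, hb2, hb3, hb4⟩ := hβtwo_lt
  have hc1p : 0 < c1 := by
    rw [hc1, hE, sub_pos, div_mul_eq_mul_div, div_lt_iff₀ hβ]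
    rw [div_mul_eq_mul_div, div_lt_iff₀ hk1] at hb1
    linarith
  have hc2p : 0 < c2 := by
    rw [hc2, hE, sub_pos, div_mul_eq_mul_div, div_lt_iff₀ hβ]
    rw [div_mul_eq_mul_div, div_lt_iff₀ hk2] at hb2
    linarith
  have hc3p : 0 < c3 := by
    rw [hc3, hE, sub_pos, div_mul_eq_mul_div, div_lt_iff₀ hβ]
    rw [div_lt_iff₀ hk3] at hb3
    linarith
  have hc4p : 0 < c4 := by
    rw [hc4, hE, sub_pos, div_mul_eq_mul_div, div_lt_iff₀ hβ]
    rw [div_mul_eq_mul_div, div_lt_iff₀ hk4] at hb4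
    linarith
  let N1 : ℕ → ℝ := fun k => ‖x1 (k + 1) - x1 k‖ ^ 2
  let N2 : ℕ → ℝ := fun k => ‖x2 (k + 1) - x2 k‖ ^ 2
  let N3 : ℕ → ℝ := fun k => ‖x3 (k + 1) - x3 k‖ ^ 2
  let N4 : ℕ → ℝ := fun k => ‖x4 (k + 1) - x4 k‖ ^ 2
  let M1 : ℕ → ℝ := fun k => ‖l1 (k + 1) - l1 k‖ ^ 2
  let M2 : ℕ → ℝ := fun k => ‖l2 (k + 1) - l2 k‖ ^ 2
  have hN1 : ∀ k, 0 ≤ N1 k := fun k => sq_nonneg _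
  have hN2 : ∀ k, 0 ≤ N2 k := fun k => sq_nonneg _
  have hN3 : ∀ k, 0 ≤ N3 k := fun k => sq_nonneg _
  have hN4 : ∀ k, 0 ≤ N4 k := fun k => sq_nonneg _
  have hM1 : ∀ k, 0 ≤ M1 k := fun k => sq_nonneg _
  have hM2 : ∀ k, 0 ≤ M2 k := fun k => sq_nonneg _
  let w1 : ℕ → E4 n := fun k => grad2f f (x1 (k + 1)) (x2 (k + 1)) (x3 k) (x4 k) +
    grad2g g (x1 (k + 1)) (x2 (k + 1)) + Matrix.toEuclideanLin H2 (x2 (k + 1) - x2 k)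
  let w2 : ℕ → E3 n := fun k =>
    grad4f f (x1 (k + 1)) (x2 (k + 1)) (x3 (k + 1)) (x4 (k + 1)) +
      Matrix.toEuclideanLin H4 (x4 (k + 1) - x4 k)
  have hw1 : ∀ k, ‖w1 (k + 1) - w1 k‖ ^ 2 ≤
      4 * (Lf ^ 2 * (N1 (k + 1) + N2 (k + 1) + N3 k + N4 k) +
        Lg ^ 2 * (N1 (k + 1) + N2 (k + 1)) + k2hi ^ 2 * N2 (k + 1) + k2hi ^ 2 * N2 k) := by
    intro k
    have hLf2 := le_sq_mul_of_sqrt_le (by positivity) (by positivity)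
      (hfLip (x1 (k + 1 + 1)) (x2 (k + 1 + 1)) (x3 (k + 1)) (x4 (k + 1))
        (x1 (k + 1)) (x2 (k + 1)) (x3 k) (x4 k))
    have hLg2' := le_sq_mul_of_sqrt_le (by positivity) (by positivity)
      (hgLip (x1 (k + 1 + 1)) (x2 (k + 1 + 1)) (x1 (k + 1)) (x2 (k + 1)))
    have hT := norm_toEuclideanLin_sq_le hH2 hk2hi (x2 (k + 1 + 1) - x2 (k + 1))
    have hT' := norm_toEuclideanLin_sq_le hH2 hk2hi (x2 (k + 1) - x2 k)
    have hsplit : w1 (k + 1) - w1 k =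
        (grad2f f (x1 (k + 1 + 1)) (x2 (k + 1 + 1)) (x3 (k + 1)) (x4 (k + 1)) -
          grad2f f (x1 (k + 1)) (x2 (k + 1)) (x3 k) (x4 k)) +
        (grad2g g (x1 (k + 1 + 1)) (x2 (k + 1 + 1)) - grad2g g (x1 (k + 1)) (x2 (k + 1))) +
        Matrix.toEuclideanLin H2 (x2 (k + 1 + 1) - x2 (k + 1)) -
        Matrix.toEuclideanLin H2 (x2 (k + 1) - x2 k) := by
      simp only [w1]
      abel
    rw [hsplit]
    refine (norm_add_four_sq_le _ _ _ _).trans (mul_le_mul_of_nonneg_left ?_ (by norm_num))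
    refine add_le_add (add_le_add (add_le_add (le_trans ?_ hLf2) (le_trans ?_ hLg2')) hT) hT'
    · have hsq : ∀ p q r s : ℝ, q ^ 2 ≤ p ^ 2 + q ^ 2 + r ^ 2 + s ^ 2 := fun p q r s => by
        linarith [sq_nonneg p, sq_nonneg r, sq_nonneg s]
      exact hsq _ _ _ _
    · exact le_add_of_nonneg_left (by positivity)
  have hw2 : ∀ k, ‖w2 (k + 1) - w2 k‖ ^ 2 ≤
      3 * (Lf ^ 2 * (N1 (k + 1) + N2 (k + 1) + N3 (k + 1) + N4 (k + 1)) +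
        k4hi ^ 2 * N4 (k + 1) + k4hi ^ 2 * N4 k) := by
    intro k
    have hLf2 := le_sq_mul_of_sqrt_le (by positivity) (by positivity)
      (hfLip (x1 (k + 1 + 1)) (x2 (k + 1 + 1)) (x3 (k + 1 + 1)) (x4 (k + 1 + 1))
        (x1 (k + 1)) (x2 (k + 1)) (x3 (k + 1)) (x4 (k + 1)))
    have hT := norm_toEuclideanLin_sq_le hH4 hk4hi (x4 (k + 1 + 1) - x4 (k + 1))
    have hT' := norm_toEuclideanLin_sq_le hH4 hk4hi (x4 (k + 1) - x4 k)
    have hsplit : w2 (k + 1) - w2 k =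
        (grad4f f (x1 (k + 1 + 1)) (x2 (k + 1 + 1)) (x3 (k + 1 + 1)) (x4 (k + 1 + 1)) -
          grad4f f (x1 (k + 1)) (x2 (k + 1)) (x3 (k + 1)) (x4 (k + 1))) +
        Matrix.toEuclideanLin H4 (x4 (k + 1 + 1) - x4 (k + 1)) -
        Matrix.toEuclideanLin H4 (x4 (k + 1) - x4 k) := by
      simp only [w2]
      abel
    rw [hsplit]
    refine (norm_add_three_sq_le _ _ _).trans (mul_le_mul_of_nonneg_left ?_ (by norm_num))
    refine add_le_add (add_le_add (le_trans ?_ hLf2) hT) hT'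
    exact le_add_of_nonneg_left (by positivity)
  have hM1w : ∀ k, 1 / (τ * β) * M1 (k + 1) + α1 / (τ * β) * M1 (k + 1) ≤
      α1 / (τ * β) * M1 k + E * ‖w1 (k + 1) - w1 k‖ ^ 2 := by
    intro k
    rw [hE, hα1, hα2]
    refine sq_norm_relaxed_le hτ hβ _ _ _ ?_
    exact relaxed_sub_relaxed (dual_eq_relaxed (opt2 (k + 1)).1 (hdual1 (k + 1)))
      (dual_eq_relaxed (opt2 k).1 (hdual1 k))
  have hM2w : ∀ k, 1 / (τ * β) * M2 (k + 1) + α1 / (τ * β) * M2 (k + 1) ≤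
      α1 / (τ * β) * M2 k + E * ‖w2 (k + 1) - w2 k‖ ^ 2 := by
    intro k
    rw [hE, hα1, hα2]
    refine sq_norm_relaxed_le hτ hβ _ _ _ ?_
    exact relaxed_sub_relaxed (dual_eq_relaxed (opt4 (k + 1)).1 (hdual2 (k + 1)))
      (dual_eq_relaxed (opt4 k).1 (hdual2 k))
  let L : ℕ → ℝ := fun k => augL f g β (x1 k) (x2 k) (x3 k) (x4 k) (l1 k) (l2 k)
  have hL : ∀ k, L (k + 1) + k1lo / 2 * N1 k + k2lo * N2 k + k3lo * N3 k + k4lo * N4 k ≤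
      L k + 1 / (τ * β) * (M1 k + M2 k) := by
    intro k
    have h1 := hmin1 k (x1 k) (hx1M k)
    rw [sub_self, qf_zero] at h1
    have h2 := (opt2 k).2
    have h3 := (opt3 k).2
    have h4 := (opt4 k).2
    have h5 := augL_dual_update (β := β) (τ := τ) f g hτβ.ne' (x1 (k + 1)) (x2 (k + 1)) (x3 (k + 1)) (x4 (k + 1))
      (l1 k) (l1 (k + 1)) (l2 k) (l2 (k + 1)) (hdual1 k) (hdual2 k)
    have q1 := mul_norm_sq_le_qf hH1.1 hk1lo (x1 (k + 1) - x1 k)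
    have q2 := mul_norm_sq_le_qf hH2.1 hk2lo (x2 (k + 1) - x2 k)
    have q3 := mul_norm_sq_le_qf hH3.1 hk3lo (x3 (k + 1) - x3 k)
    have q4 := mul_norm_sq_le_qf hH4.1 hk4lo (x4 (k + 1) - x4 k)
    simp only [L, N1, N2, N3, N4, M1, M2]
    linarith
  obtain ⟨R, hR⟩ := hbdd
  obtain ⟨C, hC⟩ := exists_le_augL hf.continuous hg.continuous β R
  have hLC : ∀ k, C ≤ L k := fun k => by
    obtain ⟨r1, r2, r3, r4, r5, r6⟩ := hR k
    exact hC _ _ _ _ _ _ r1 r2 r3 r4 r5 r6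
  have hsum : Summable fun k =>
      c1 * N1 (k + 1) + c2 * N2 (k + 1) + c3 * N3 (k + 1) + c4 * N4 (k + 1) := by
    refine summable_of_add_le_add (Φ := fun k => L (k + 1) + α1 / (τ * β) * (M1 k + M2 k) +
      E * (4 * k2hi ^ 2 * N2 k + 4 * Lf ^ 2 * N3 k + (4 * Lf ^ 2 + 3 * k4hi ^ 2) * N4 k))
      (b := fun _ => 0) (C := C) (fun k => ?_) (fun k => ?_) (fun _ => le_rfl) summable_zero
      fun k => ?_
    · have e1 := mul_le_mul_of_nonneg_left (hw1 k) hEn.le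
      have e2 := mul_le_mul_of_nonneg_left (hw2 k) hEn.le
      rw [hc1, hc2, hc3, hc4]
      linarith [hL (k + 1), hM1w k, hM2w k]
    · have := hN1 (k + 1)
      have := hN2 (k + 1)
      have := hN3 (k + 1)
      have := hN4 (k + 1)
      positivity
    · have := hN2 k
      have := hN3 k
      have := hN4 k
      have := hM1 k
      have := hM2 k
      have h0 : 0 ≤ α1 / (τ * β) * (M1 k + M2 k) := by positivity
      have h1 : 0 ≤ E * (4 * k2hi ^ 2 * N2 k + 4 * Lf ^ 2 * N3 k +
        (4 * Lf ^ 2 + 3 * k4hi ^ 2) * N4 k) := by positivity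
      linarith [hLC (k + 1)]
  have hsN : ∀ (c : ℝ) (N : ℕ → ℝ), 0 < c → (∀ k, 0 ≤ N k) → (∀ k, c * N (k + 1) ≤
      c1 * N1 (k + 1) + c2 * N2 (k + 1) + c3 * N3 (k + 1) + c4 * N4 (k + 1)) →
      Summable N := fun c N hc hN hle => by
    refine (summable_nat_add_iff 1).1 ((summable_mul_left_iff hc.ne').1 ?_)
    exact Summable.of_nonneg_of_le (fun k => mul_nonneg hc.le (hN _)) hle hsum
  have hcN1 := fun k => mul_nonneg hc1p.le (hN1 k)
  have hcN2 := fun k => mul_nonneg hc2p.le (hN2 k)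
  have hcN3 := fun k => mul_nonneg hc3p.le (hN3 k)
  have hcN4 := fun k => mul_nonneg hc4p.le (hN4 k)
  have hs1 : Summable N1 := hsN c1 N1 hc1p hN1 fun k => by
    linarith [hcN1 (k + 1), hcN2 (k + 1), hcN3 (k + 1), hcN4 (k + 1)]
  have hs2 : Summable N2 := hsN c2 N2 hc2p hN2 fun k => by
    linarith [hcN1 (k + 1), hcN2 (k + 1), hcN3 (k + 1), hcN4 (k + 1)]
  have hs3 : Summable N3 := hsN c3 N3 hc3p hN3 fun k => by
    linarith [hcN1 (k + 1), hcN2 (k + 1), hcN3 (k + 1), hcN4 (k + 1)]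
  have hs4 : Summable N4 := hsN c4 N4 hc4p hN4 fun k => by
    linarith [hcN1 (k + 1), hcN2 (k + 1), hcN3 (k + 1), hcN4 (k + 1)]
  have ht1 := (summable_nat_add_iff 1).2 hs1
  have ht2 := (summable_nat_add_iff 1).2 hs2
  have ht3 := (summable_nat_add_iff 1).2 hs3
  have ht4 := (summable_nat_add_iff 1).2 hs4
  have hsw1 : Summable fun k => ‖w1 (k + 1) - w1 k‖ ^ 2 :=
    Summable.of_nonneg_of_le (fun k => sq_nonneg _) hw1
      ((((((((ht1.add ht2).add hs3).add hs4).mul_left _).add ((ht1.add ht2).mul_left _)).add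
        (ht2.mul_left _)).add (hs2.mul_left _)).mul_left _)
  have hsw2 : Summable fun k => ‖w2 (k + 1) - w2 k‖ ^ 2 :=
    Summable.of_nonneg_of_le (fun k => sq_nonneg _) hw2
      (((((((ht1.add ht2).add ht3).add ht4).mul_left _).add (ht4.mul_left _)).add
        (hs4.mul_left _)).mul_left _)
  have hsM : ∀ (M W : ℕ → ℝ), (∀ k, 0 ≤ M k) → (∀ k, 0 ≤ W k) → Summable W →
      (∀ k, 1 / (τ * β) * M (k + 1) + α1 / (τ * β) * M (k + 1) ≤ α1 / (τ * β) * M k + E * W k) →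
      Summable fun k => M (k + 1) := fun M W hM hW hWs hle => by
    rw [← summable_mul_left_iff (one_div_pos.2 hτβ).ne']
    refine summable_of_add_le_add (Φ := fun k => α1 / (τ * β) * M k) (b := fun k => E * W k)
      (C := 0) (fun k => by linarith [hle k])
      (fun k => mul_nonneg (one_div_pos.2 hτβ).le (hM _)) (fun k => mul_nonneg hEn.le (hW k))
      (hWs.mul_left E) fun k => mul_nonneg (div_nonneg hα1n hτβ.le) (hM k)
  have hD1 := tendsto_zero_of_summable_norm_sq (u := fun k => x1 (k + 1) - x1 k) ht1
  have hD2 := tendsto_zero_of_summable_norm_sq (u := fun k => x2 (k + 1) - x2 k) ht2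
  have hD3 := tendsto_zero_of_summable_norm_sq (u := fun k => x3 (k + 1) - x3 k) ht3
  have hD4 := tendsto_zero_of_summable_norm_sq (u := fun k => x4 (k + 1) - x4 k) ht4
  have hDl1 := tendsto_zero_of_summable_norm_sq (u := fun k => l1 (k + 1) - l1 k)
    (hsM M1 _ hM1 (fun k => sq_nonneg _) hsw1 hM1w)
  have hDl2 := tendsto_zero_of_summable_norm_sq (u := fun k => l2 (k + 1) - l2 k)
    (hsM M2 _ hM2 (fun k => sq_nonneg _) hsw2 hM2w)
  refine ⟨⟨hD1, hD2, hD3, hD4, hDl1, hDl2⟩, ?_⟩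
  rintro y1 y2 y3 y4 m1 m2 ⟨φ, hφ, hy1, hy2, hy3, hy4, hm1, hm2⟩
  have hφt := hφ.tendsto_atTop
  have hz1 := tendsto_succ_of_tendsto_sub hφt hD1 hy1
  have hz2 := tendsto_succ_of_tendsto_sub hφt hD2 hy2
  have hz3 := tendsto_succ_of_tendsto_sub hφt hD3 hy3
  have hz4 := tendsto_succ_of_tendsto_sub hφt hD4 hy4
  have hy1M : y1 ∈ Msph n :=
    (isClosed_Msph n).mem_of_tendsto hy1 (Filter.Eventually.of_forall fun j => hx1M (φ j))
  have h12 : y1 = y2 := eq_of_tendsto_dual hτβ.ne' hφt hDl1 hdual1 hz1 hz2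
  have h34 : y3 = y4 := eq_of_tendsto_dual hτβ.ne' hφt hDl2 hdual2 hz3 hz4
  have hfc := hf.continuous
  have hgc := hg.continuous
  have lim1 := projM_eq_zero_of_augL_min (a := y1) (l1 := m1) (l2 := m2) (b := y2) (c := y3)
    (d := y4) hf hg β hH1.1 hy1M fun y hy => le_of_tendsto_of_tendsto'
      ((tendsto_augL hfc hgc β hz1 hy2 hy3 hy4 hm1 hm2).add
        ((((continuous_qf H1).tendsto _).comp (hz1.sub hy1)).const_mul (1 / 2)))
      ((tendsto_augL hfc hgc β tendsto_const_nhds hy2 hy3 hy4 hm1 hm2).add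
        ((((continuous_qf H1).tendsto _).comp (tendsto_const_nhds.sub hy1)).const_mul (1 / 2)))
      fun j => hmin1 (φ j) y hy
  have lim2 := (second_block_prox_step (a := y1) (b := y2) (b' := y2) (c := y3)
    (d := y4) (l1 := m1) (l2 := m2) hf hg hfconv2 hgconv2 hβ hH2.1
    fun y => le_of_tendsto_of_tendsto'
      ((tendsto_augL hfc hgc β hz1 hz2 hy3 hy4 hm1 hm2).add
        ((((continuous_qf H2).tendsto _).comp (hz2.sub hy2)).const_mul (1 / 2)))
      ((tendsto_augL hfc hgc β hz1 tendsto_const_nhds hy3 hy4 hm1 hm2).add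
        ((((continuous_qf H2).tendsto _).comp (tendsto_const_nhds.sub hy2)).const_mul (1 / 2)))
      fun j => hmin2 (φ j) y).1
  have lim3 := (third_block_prox_step (a := y1) (b := y2) (c := y3) (c' := y3)
    (d := y4) (l1 := m1) (l2 := m2) hf hfconv3 hβ hH3.1
    fun y => le_of_tendsto_of_tendsto'
      ((tendsto_augL hfc hgc β hz1 hz2 hz3 hy4 hm1 hm2).add
        ((((continuous_qf H3).tendsto _).comp (hz3.sub hy3)).const_mul (1 / 2)))
      ((tendsto_augL hfc hgc β hz1 hz2 tendsto_const_nhds hy4 hm1 hm2).add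
        ((((continuous_qf H3).tendsto _).comp (tendsto_const_nhds.sub hy3)).const_mul (1 / 2)))
      fun j => hmin3 (φ j) y).1
  have lim4 := (fourth_block_prox_step (a := y1) (b := y2) (c := y3) (d := y4)
    (d' := y4) (l1 := m1) (l2 := m2) hf hfconv4 hβ hH4.1
    fun y => le_of_tendsto_of_tendsto'
      ((tendsto_augL hfc hgc β hz1 hz2 hz3 hz4 hm1 hm2).add
        ((((continuous_qf H4).tendsto _).comp (hz4.sub hy4)).const_mul (1 / 2)))
      ((tendsto_augL hfc hgc β hz1 hz2 hz3 tendsto_const_nhds hm1 hm2).add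
        ((((continuous_qf H4).tendsto _).comp (tendsto_const_nhds.sub hy4)).const_mul (1 / 2)))
      fun j => hmin4 (φ j) y).1
  subst h12 h34
  simp only [sub_self, smul_zero, map_zero, add_zero] at lim1 lim2 lim3 lim4
  exact ⟨hy1M, rfl, rfl, by rwa [← sub_eq_add_neg] at lim1, lim2,
    by rwa [← sub_eq_add_neg, sub_eq_zero] at lim3, eq_neg_of_add_eq_zero_left lim4⟩

end
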